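/- For every finite-dimensional complex representation L of S_n, the following identity of polynomials in the variable u holds: n!·(1 − u)·∑_{k=0}^{n−1} (−u)^k · dim_ℂ Hom_{S_n}(Λ^k 𝔥, L) = ∑_{σ ∈ S_n} χ_L(σ) · ∏_{i≥1} (1 − u^i)^{k_i(σ)}, where χ_L is the character of L and k_i(σ) is the number of cycles of σ of length i (fixed points counting as cycles of length 1). -/

import Mathlib

noncomputable section

/-- The linear functional `v ↦ ∑ i, v i` on `ℂ^n`. -/
def sumCoords (n : ℕ) : (Fin n → ℂ) →ₗ[ℂ] ℂ := ∑ i, LinearMap.proj i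

/-- The reflection representation `𝔥 = {v ∈ ℂ^n : ∑ vᵢ = 0}` of `S_n`. -/
def reflRep (n : ℕ) : Submodule ℂ (Fin n → ℂ) := LinearMap.ker (sumCoords n)

/-- The permutation action of `σ ∈ S_n` on `ℂ^n`, `(σ·v) i = v (σ⁻¹ i)`. -/
def permLin (n : ℕ) (σ : Equiv.Perm (Fin n)) : (Fin n → ℂ) →ₗ[ℂ] (Fin n → ℂ) :=
  LinearMap.funLeft ℂ ℂ ⇑σ⁻¹

lemma permLin_mem (n : ℕ) (σ : Equiv.Perm (Fin n)) :
    ∀ v ∈ reflRep n, permLin n σ v ∈ reflRep n := by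
  intro v hv
  have hv' : ∑ i, v i = 0 := by
    simpa [reflRep, sumCoords, LinearMap.mem_ker] using hv
  simp only [reflRep, sumCoords, LinearMap.mem_ker, LinearMap.sum_apply,
    LinearMap.proj_apply, permLin, LinearMap.funLeft_apply]
  rw [Equiv.sum_comp σ⁻¹ v]
  exact hv'

/-- The action of `σ ∈ S_n` on the reflection representation `𝔥`. -/
def reflAction (n : ℕ) (σ : Equiv.Perm (Fin n)) : reflRep n →ₗ[ℂ] reflRep n :=
  (permLin n σ).restrict (permLin_mem n σ)

lemma extmap_mem {R : Type*} [CommRing R] {M : Type*} [AddCommGroup M] [Module R M]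
    (k : ℕ) (f : M →ₗ[R] M) :
    ∀ x ∈ ⋀[R]^k M, ExteriorAlgebra.map f x ∈ ⋀[R]^k M := by
  intro x hx
  have h : Submodule.map (ExteriorAlgebra.map f).toLinearMap (⋀[R]^k M) ≤ ⋀[R]^k M := by
    rw [show (⋀[R]^k M) = LinearMap.range (ExteriorAlgebra.ι R (M := M)) ^ k from rfl,
      Submodule.map_pow, ExteriorAlgebra.ι_range_map_map]
    refine pow_le_pow_left' ?_ k
    exact (Submodule.map_mono le_top).trans (le_of_eq (Submodule.map_top _))
  exact h ⟨x, hx, rfl⟩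

/-- The map induced on the `k`-th exterior power by an endomorphism. -/
def extPowerMap {R : Type*} [CommRing R] {M : Type*} [AddCommGroup M] [Module R M]
    (k : ℕ) (f : M →ₗ[R] M) : ⋀[R]^k M →ₗ[R] ⋀[R]^k M :=
  (ExteriorAlgebra.map f).toLinearMap.restrict (extmap_mem k f)

/-- The space of `S_n`-equivariant linear maps `Λ^k 𝔥 → L`, where `S_n` acts on
`Λ^k 𝔥` via the action induced on the exterior power by the reflection
representation, and on `L` via a representation `ρ`. -/
def equivHoms (n k : ℕ) {L : Type*} [AddCommGroup L] [Module ℂ L]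
    (ρ : Representation ℂ (Equiv.Perm (Fin n)) L) :
    Submodule ℂ ((⋀[ℂ]^k (reflRep n)) →ₗ[ℂ] L) where
  carrier := {f | ∀ σ : Equiv.Perm (Fin n),
    ρ σ ∘ₗ f = f ∘ₗ extPowerMap k (reflAction n σ)}
  add_mem' := by
    intro f g hf hg σ
    rw [LinearMap.comp_add, LinearMap.add_comp, hf σ, hg σ]
  zero_mem' := by
    intro σ
    simp
  smul_mem' := by
    intro a f hf σ
    rw [LinearMap.comp_smul, LinearMap.smul_comp, hf σ]


section Helpers

lemma hx_coe {M : Type*} [AddCommGroup M] [Module ℂ M] (k : ℕ) (f : M →ₗ[ℂ] M) (x : ⋀[ℂ]^k M) :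
    (extPowerMap k f x : ExteriorAlgebra ℂ M) = ExteriorAlgebra.map f x := rfl

open Polynomial in
lemma hx_trace_ext {M : Type*} [AddCommGroup M] [Module ℂ M] [FiniteDimensional ℂ M]
    (f : M →ₗ[ℂ] M) (k : ℕ) {d : ℕ} (b : Module.Basis (Fin d) ℂ M) :
    LinearMap.trace ℂ _ (extPowerMap k f) =
      (Matrix.det (1 + (X : ℂ[X]) • (LinearMap.toMatrix b b f).map C)).coeff k := by
  rw [Matrix.coeff_det_one_add_X_smul_eq_sum_minors]
  rw [LinearMap.trace_eq_matrix_trace ℂ (b.exteriorPower k)]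
  rw [Matrix.trace]
  have key : ∀ s : Set.powersetCard (Fin d) k,
      (LinearMap.toMatrix (b.exteriorPower k) (b.exteriorPower k) (extPowerMap k f)).diag s =
      ((LinearMap.toMatrix b b f).submatrix (Subtype.val : s.val → Fin d)
        (Subtype.val : s.val → Fin d)).det := by
    intro s
    rw [Matrix.diag_apply, LinearMap.toMatrix_apply, exteriorPower.basis_repr_apply,
      exteriorPower.basis_apply]
    have h1 : extPowerMap k f (exteriorPower.ιMulti_family ℂ k b s) =
        exteriorPower.ιMulti ℂ k (fun i => f (b (Set.powersetCard.ofFinEmbEquiv.symm s i))) := by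
      apply Subtype.ext
      rw [hx_coe, exteriorPower.ιMulti_family, exteriorPower.ιMulti_apply_coe,
        exteriorPower.ιMulti_apply_coe, ExteriorAlgebra.map_apply_ιMulti]
      rfl
    rw [h1, exteriorPower.ιMultiDual_apply_ιMulti, ← Matrix.det_transpose,
      ← Matrix.det_submatrix_equiv_self (s.val.orderIsoOfFin s.prop).toEquiv]
    congr 1
    ext i j
    simp [LinearMap.toMatrix_apply, Set.powersetCard.ofFinEmbEquiv_symm_apply]
    rfl
  rw [Finset.sum_congr rfl (fun s _ => key s)]
  symm
  refine Finset.sum_bij' (fun s hs => (⟨s, (Finset.mem_powersetCard.1 hs).2⟩ : Set.powersetCard (Fin d) k))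
    (fun s _ => s.val) ?_ ?_ ?_ ?_ ?_
  · intro s hs; exact Finset.mem_univ _
  · intro s hs
    exact Finset.mem_powersetCard.2 ⟨Finset.subset_univ _, s.prop⟩
  · intro s hs; rfl
  · intro s hs; rfl
  · intro s hs; rfl

open Polynomial in
lemma hx_sum_trace_ext {M : Type*} [AddCommGroup M] [Module ℂ M] [FiniteDimensional ℂ M]
    (f : M →ₗ[ℂ] M) (u : ℂ) (m : ℕ) (hm : Module.finrank ℂ M < m) :
    ∑ k ∈ Finset.range m, (-u) ^ k * LinearMap.trace ℂ _ (extPowerMap k f) =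
      LinearMap.det (LinearMap.id - u • f) := by
  let b := Module.finBasis ℂ M
  set p := (Matrix.det (1 + (X : ℂ[X]) • (LinearMap.toMatrix b b f).map C)) with hp
  have hdeg : p.natDegree < m := by
    refine lt_of_le_of_lt ?_ hm
    have := Polynomial.natDegree_det_X_add_C_le (LinearMap.toMatrix b b f) 1
    simp only [Fintype.card_fin] at this
    rw [hp, add_comm]
    simpa using this
  have h1 := Polynomial.eval_eq_sum_range' hdeg (-u)
  rw [← LinearMap.det_toMatrix b]
  have h2 : p.eval (-u) = (LinearMap.toMatrix b b (LinearMap.id - u • f)).det := by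
    rw [hp, ← Polynomial.coe_evalRingHom, RingHom.map_det]
    congr 1
    ext i j
    simp [Matrix.one_apply, sub_eq_add_neg]
    split_ifs <;> simp [mul_comm]
  rw [← h2, h1]
  refine Finset.sum_congr rfl fun k _ => ?_
  rw [hx_trace_ext f k b, mul_comm]

lemma hx_finrank_quot (n : ℕ) (hn : 1 ≤ n) :
    Module.finrank ℂ ((Fin n → ℂ) ⧸ reflRep n) = 1 := by
  have hs : Function.Surjective (sumCoords n) := by
    apply LinearMap.surjective
    intro h
    have := LinearMap.congr_fun h (Pi.single ⟨0, hn⟩ 1)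
    simp [sumCoords] at this
  rw [reflRep, ((sumCoords n).quotKerEquivOfSurjective hs).finrank_eq]
  simp

lemma hx_finrank (n : ℕ) (hn : 1 ≤ n) : Module.finrank ℂ (reflRep n) < n := by
  have h1 := hx_finrank_quot n hn
  have h2 := Submodule.finrank_quotient_add_finrank (reflRep n)
  rw [h1] at h2
  simp at h2
  omega

lemma hx_det_refl (n : ℕ) (hn : 1 ≤ n) (σ : Equiv.Perm (Fin n)) (u : ℂ) :
    (1 - u) * LinearMap.det (LinearMap.id - u • reflAction n σ) =
      LinearMap.det (LinearMap.id - u • permLin n σ) := by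
  have he : reflRep n ≤ (reflRep n).comap (LinearMap.id - u • permLin n σ) := by
    intro v hv
    exact (reflRep n).sub_mem hv ((reflRep n).smul_mem u (permLin_mem n σ v hv))
  rw [LinearMap.det_eq_det_mul_det (reflRep n) _ he, mul_comm]
  have h1 : (LinearMap.id - u • permLin n σ).restrict he = LinearMap.id - u • reflAction n σ := by
    ext v
    rfl
  have h2 : (reflRep n).mapQ (reflRep n) (LinearMap.id - u • permLin n σ) he =
      (1 - u) • LinearMap.id := by
    apply Submodule.linearMap_qext
    refine LinearMap.ext fun v => ?_
    change Submodule.Quotient.mk (v - u • permLin n σ v) =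
      (1 - u) • Submodule.Quotient.mk (p := reflRep n) v
    rw [← Submodule.Quotient.mk_smul, Submodule.Quotient.eq]
    simp only [reflRep, LinearMap.mem_ker, map_sub, map_smul, LinearMap.sub_apply,
      LinearMap.smul_apply, LinearMap.id_apply]
    have : sumCoords n (permLin n σ v) = sumCoords n v := by
      simp only [sumCoords, LinearMap.sum_apply, LinearMap.proj_apply, permLin,
        LinearMap.funLeft_apply]
      exact Equiv.sum_comp σ⁻¹ v
    rw [this]
    simp only [smul_eq_mul]
    ring
  rw [h1, h2, LinearMap.det_smul, hx_finrank_quot n hn]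
  simp

/-- The matrix of a permutation with its fixed points erased. -/
def hxMat {n : ℕ} (σ : Equiv.Perm (Fin n)) (u : ℂ) : Matrix (Fin n) (Fin n) ℂ :=
  fun i j => if σ i ≠ i ∧ σ i = j then u else 0

lemma hx_det_cycle {n : ℕ} (σ : Equiv.Perm (Fin n)) (hσ : σ.IsCycle) (u : ℂ) :
    (1 - hxMat σ u).det = 1 - u ^ σ.support.card := by
  classical
  rw [← Matrix.det_transpose, Matrix.det_apply]
  have hne : (1 : Equiv.Perm (Fin n)) ≠ σ := fun h => hσ.ne_one h.symm
  rw [← Finset.sum_subset (Finset.subset_univ ({1, σ} : Finset (Equiv.Perm (Fin n))))]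
  · rw [Finset.sum_pair hne]
    have e1 : ∏ i, (1 - hxMat σ u).transpose ((1 : Equiv.Perm (Fin n)) i) i = 1 := by
      apply Finset.prod_eq_one
      intro i _
      simp +contextual [hxMat]
    have e2 : ∏ i, (1 - hxMat σ u).transpose (σ i) i = (-u) ^ σ.support.card := by
      rw [← Finset.prod_subset (Finset.subset_univ σ.support)]
      · rw [Finset.prod_eq_pow_card]
        intro i hi
        have hi' : σ i ≠ i := by simpa using hi
        simp [hxMat, hi', Matrix.one_apply, hi'.symm]
      · intro i _ hi
        have hi' : σ i = i := by simpa using hi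
        simp [hxMat, hi']
    rw [e1, e2, hσ.sign]
    have : (-u) ^ σ.support.card = (-1) ^ σ.support.card * u ^ σ.support.card := by
      rw [← mul_pow]; simp
    rw [this, Units.smul_def, Units.smul_def, zsmul_eq_mul, zsmul_eq_mul]
    have h3 : ((-1 : ℂ)) ^ σ.support.card * (-1) ^ σ.support.card = 1 := by
      rw [← mul_pow]; simp
    push_cast
    simp only [Equiv.Perm.sign_one, Units.val_one, Int.cast_one]
    linear_combination (-u ^ σ.support.card) * h3
  · intro τ _ hτ
    by_contra hprod
    have hne0 : ∀ i, (1 - hxMat σ u).transpose (τ i) i ≠ 0 := by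
      intro i hi
      apply hprod
      have hz : ∏ i, (1 - hxMat σ u).transpose (τ i) i = 0 :=
        Finset.prod_eq_zero (Finset.mem_univ i) hi
      rw [hz, smul_zero]
    have hor : ∀ i, τ i = i ∨ (σ i ≠ i ∧ τ i = σ i) := by
      intro i
      by_contra hcon
      push Not at hcon
      apply hne0 i
      obtain ⟨ha, hb⟩ := hcon
      have : ¬ (σ i ≠ i ∧ σ i = τ i) := fun h => hb h.1 h.2.symm
      simp [hxMat, Matrix.one_apply, Ne.symm ha]
      tauto
    simp only [Finset.mem_insert, Finset.mem_singleton, not_or] at hτ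
    apply hτ.2
    obtain ⟨x, hx⟩ : ∃ x, τ x ≠ x := by
      by_contra hcon
      push Not at hcon
      exact hτ.1 (Equiv.ext hcon)
    have hstep : ∀ y, τ y ≠ y → τ (σ y) ≠ σ y := by
      intro y hy hcon
      rcases hor y with h | h
      · exact hy h
      · rw [← h.2] at hcon
        exact hy (τ.injective hcon)
    have hpow : ∀ k : ℕ, τ ((σ ^ k) x) ≠ (σ ^ k) x := by
      intro k
      induction k with
      | zero => simpa using hx
      | succ k ih => rw [pow_succ', Equiv.Perm.mul_apply]; exact hstep _ ih
    have hσx : σ x ≠ x := by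
      rcases hor x with h | h
      · exact absurd h hx
      · exact h.1
    ext1 y
    by_cases hy : σ y = y
    · rcases hor y with h | h
      · rw [h, hy]
      · exact absurd hy h.1
    · obtain ⟨k, hk⟩ := hσ.exists_pow_eq hσx hy
      rcases hor y with h | h
      · exact absurd (hk ▸ h) (hk ▸ hpow k)
      · exact h.2

lemma hx_mat_mul {n : ℕ} (σ τ : Equiv.Perm (Fin n)) (h : σ.Disjoint τ) (u : ℂ) :
    1 - hxMat (σ * τ) u = (1 - hxMat σ u) * (1 - hxMat τ u) := by
  have h0 : hxMat σ u * hxMat τ u = 0 := by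
    ext i j
    rw [Matrix.mul_apply, Matrix.zero_apply]
    apply Finset.sum_eq_zero
    intro k _
    simp only [hxMat]
    by_cases h1 : σ i ≠ i ∧ σ i = k
    · have h2 : τ k = k := by
        rcases h k with h3 | h3
        · exact absurd (σ.injective (h1.2.trans h3.symm)) (by rintro rfl; exact h1.1 h1.2)
        · exact h3
      simp [h2]
    · simp [h1]
  have h1 : hxMat (σ * τ) u = hxMat σ u + hxMat τ u := by
    ext i j
    simp only [hxMat, Matrix.add_apply, Equiv.Perm.mul_apply]
    rcases h i with hi | hi
    · have h4 : σ (τ i) = τ i := by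
        rcases h (τ i) with h3 | h3
        · exact h3
        · rw [τ.injective h3, hi]
      simp [hi, h4]
    · simp [hi]
  rw [h1, sub_mul, mul_sub, mul_sub, h0]
  simp
  abel

lemma hx_det_mat {n : ℕ} (σ : Equiv.Perm (Fin n)) (u : ℂ) :
    (1 - hxMat σ u).det = (σ.cycleType.map fun i => 1 - u ^ i).prod := by
  induction σ using Equiv.Perm.cycle_induction_on with
  | base_one =>
    have : hxMat (1 : Equiv.Perm (Fin n)) u = 0 := by ext; simp [hxMat]
    simp [this]
  | base_cycles σ hσ => rw [hx_det_cycle σ hσ, hσ.cycleType]; simp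
  | induction_disjoint σ τ hd _ hσ hτ =>
    rw [hx_mat_mul σ τ hd, Matrix.det_mul, hσ, hτ, hd.cycleType_mul]; simp

lemma hx_det_perm (n : ℕ) (σ : Equiv.Perm (Fin n)) (u : ℂ) :
    LinearMap.det (LinearMap.id - u • permLin n σ⁻¹) =
      (1 - u) ^ (Finset.univ.filter fun x => σ x = x).card *
            (σ.cycleType.map fun i => 1 - u ^ i).prod := by
  classical
  rw [← LinearMap.det_toMatrix', ← hx_det_mat]
  have hm : LinearMap.toMatrix' (LinearMap.id - u • permLin n σ⁻¹) =
      Matrix.diagonal (fun i => if σ i = i then 1 - u else 1) * (1 - hxMat σ u) := by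
    ext i j
    rw [Matrix.diagonal_mul]
    simp only [LinearMap.toMatrix'_apply, hxMat, permLin, Matrix.sub_apply, Matrix.one_apply,
      LinearMap.sub_apply, LinearMap.smul_apply, LinearMap.id_apply, LinearMap.funLeft_apply,
      Pi.sub_apply, Pi.smul_apply, inv_inv, Pi.single_apply, smul_eq_mul]
    by_cases h : σ i = i
    · simp [h]; split_ifs <;> simp
    · simp [h]
  rw [hm, Matrix.det_mul, Matrix.det_diagonal, Finset.prod_ite]
  simp

lemma hx_finrank_hom (n k : ℕ) {L : Type*} [AddCommGroup L] [Module ℂ L] [FiniteDimensional ℂ L]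
    (ρ : Representation ℂ (Equiv.Perm (Fin n)) L) :
    (n.factorial : ℂ) * (Module.finrank ℂ (equivHoms n k ρ) : ℂ) =
      ∑ σ : Equiv.Perm (Fin n), LinearMap.trace ℂ L (ρ σ) *
        LinearMap.trace ℂ _ (extPowerMap k (reflAction n σ⁻¹)) := by
  let Λ : Representation ℂ (Equiv.Perm (Fin n)) (⋀[ℂ]^k (reflRep n)) :=
    { toFun := fun σ => extPowerMap k (reflAction n σ)
      map_one' := by
        have : reflAction n 1 = LinearMap.id := by ext v; rfl
        ext x
        simp [this, extPowerMap]
      map_mul' := by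
        intro σ τ
        have : reflAction n (σ * τ) = reflAction n σ ∘ₗ reflAction n τ := by ext v; rfl
        apply LinearMap.ext
        intro x
        apply Subtype.ext
        rw [Module.End.mul_apply, hx_coe, hx_coe, hx_coe, this, ← ExteriorAlgebra.map_comp_map]
        rfl }
  have hcard : Nat.card (Equiv.Perm (Fin n)) = n.factorial := by
    rw [Nat.card_eq_fintype_card, Fintype.card_perm, Fintype.card_fin]
  have hfac : (n.factorial : ℂ) ≠ 0 := by exact_mod_cast n.factorial_ne_zero
  have : Invertible (Nat.card (Equiv.Perm (Fin n)) : ℂ) :=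
    invertibleOfNonzero (by rw [hcard]; exact hfac)
  have hinv : equivHoms n k ρ = (Representation.linHom Λ ρ).invariants := by
    ext f
    rw [Representation.mem_invariants]
    constructor
    · intro hf σ
      rw [Representation.linHom_apply, ← LinearMap.comp_assoc, hf σ, LinearMap.comp_assoc]
      change f ∘ₗ (Λ σ * Λ σ⁻¹) = f
      rw [← map_mul]; simp; rfl
    · intro hf σ
      have := hf σ
      rw [Representation.linHom_apply] at this
      conv_rhs => rw [← this]
      change _ = ρ σ ∘ₗ f ∘ₗ (Λ σ⁻¹ * Λ σ)
      rw [← map_mul]; simp; rfl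
  have h := Representation.card_inv_mul_sum_char_eq_finrank (Representation.linHom Λ ρ)
  rw [hinv, ← h, hcard, mul_inv_cancel_left₀ hfac]
  refine Finset.sum_congr rfl fun σ _ => ?_
  rw [Representation.char_linHom, mul_comm]
  rfl

end Helpers

/-- For every finite-dimensional complex representation `L` of `S_n`,
`n!·(1 − u)·∑_{k=0}^{n−1} (−u)^k·dim Hom_{S_n}(Λ^k 𝔥, L)
  = ∑_{σ ∈ S_n} χ_L(σ)·∏_{i≥1} (1 − u^i)^{k_i(σ)}`,
where `k_i(σ)` is the number of cycles of `σ` of length `i` (fixed points contribute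
the factor `(1 − u)^{k_1(σ)}`; cycles of length `≥ 2` are recorded by `σ.cycleType`).
The polynomial identity in `u` is expressed via evaluation at every `u ∈ ℂ`. -/
theorem hom_exterior_character_identity (n : ℕ) (hn : 1 ≤ n)
    {L : Type*} [AddCommGroup L] [Module ℂ L] [FiniteDimensional ℂ L]
    (ρ : Representation ℂ (Equiv.Perm (Fin n)) L) (u : ℂ) :
    (n.factorial : ℂ) * (1 - u) *
        ∑ k ∈ Finset.range n, (-u) ^ k * (Module.finrank ℂ (equivHoms n k ρ) : ℂ)
      = ∑ σ : Equiv.Perm (Fin n), LinearMap.trace ℂ L (ρ σ) *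
          ((1 - u) ^ (Finset.univ.filter fun x => σ x = x).card *
            (σ.cycleType.map fun i => 1 - u ^ i).prod) := by
  have h1 : (n.factorial : ℂ) * (1 - u) *
        ∑ k ∈ Finset.range n, (-u) ^ k * (Module.finrank ℂ (equivHoms n k ρ) : ℂ) =
      (1 - u) * ∑ k ∈ Finset.range n, (-u) ^ k *
        ((n.factorial : ℂ) * (Module.finrank ℂ (equivHoms n k ρ) : ℂ)) := by
    rw [mul_comm (n.factorial : ℂ), mul_assoc, Finset.mul_sum]
    congr 1
    exact Finset.sum_congr rfl fun k _ => by ring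
  rw [h1]
  simp_rw [hx_finrank_hom, ← hx_det_perm, ← hx_det_refl n hn,
    ← hx_sum_trace_ext _ u n (hx_finrank n hn), Finset.mul_sum]
  rw [Finset.sum_comm]
  exact Finset.sum_congr rfl fun σ _ => Finset.sum_congr rfl fun k _ => by ring
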